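/- arXiv:0806.1774 — 11 statements merged into one kernel-verified Lean document; each statement's English description precedes it below -/
import Mathlib

section
/- A partition λ has a disconnected ladder — that is, there exists l ≥ 1 such that L_l(λ) is disconnected — if and only if there exist indices 1 ≤ a < b such that λ_a − λ_{a+1} ≥ 2 and λ_b = λ_{b+1} > 0. -/
/-- `lam` represents a partition: the parts are `lam 1, lam 2, …`, weakly decreasing,
with finitely many nonzero parts.  (The value at index `0` is ignored.) -/
def IsPartition (lam : ℕ → ℕ) : Prop :=
  (∀ i, 1 ≤ i → lam (i + 1) ≤ lam i) ∧ ∃ N, ∀ i, N ≤ i → lam i = 0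

/-- The Young diagram of `lam`: the nodes `(i,j)` with `i,j ≥ 1` and `j ≤ lam i`. -/
def diagram (lam : ℕ → ℕ) : Set (ℕ × ℕ) :=
  {p | 1 ≤ p.1 ∧ 1 ≤ p.2 ∧ p.2 ≤ lam p.1}

/-- The `l`-th ladder `L_l(lam)` of `lam` is disconnected: there are `1 ≤ a < b < c ≤ l`
with `(a, l+1-a), (c, l+1-c) ∈ [lam]` but `(b, l+1-b) ∉ [lam]`. -/
def LadderDisconnected (lam : ℕ → ℕ) (l : ℕ) : Prop :=
  ∃ a b c, 1 ≤ a ∧ a < b ∧ b < c ∧ c ≤ l ∧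
    (a, l + 1 - a) ∈ diagram lam ∧ (b, l + 1 - b) ∉ diagram lam ∧
    (c, l + 1 - c) ∈ diagram lam

theorem IsPartition.le_of_le {lam : ℕ → ℕ} (hlam : IsPartition lam) {i j : ℕ} (hi : 1 ≤ i)
    (hij : i ≤ j) : lam j ≤ lam i := by
  induction j, hij using Nat.le_induction with
  | base => exact le_rfl
  | succ k hk ih => exact (hlam.1 k (hi.trans hk)).trans ih

theorem exists_succ_lt_of_lt {α : Type*} [LinearOrder α] (f : ℕ → α) {a b : ℕ} (hab : a ≤ b)
    (h : f b < f a) : ∃ i, a ≤ i ∧ i < b ∧ f (i + 1) < f i := by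
  by_contra! hf
  suffices ∀ k, a ≤ k → k ≤ b → f a ≤ f k from (this b hab le_rfl).not_gt h
  intro k hk
  induction k, hk using Nat.le_induction with
  | base => exact fun _ => le_rfl
  | succ k hk ih => exact fun hkb => (ih (by lia)).trans (hf k hk (by lia))

theorem exists_lt_succ_of_lt {α : Type*} [LinearOrder α] (f : ℕ → α) {a b : ℕ} (hab : a ≤ b)
    (h : f a < f b) : ∃ i, a ≤ i ∧ i < b ∧ f i < f (i + 1) :=
  exists_succ_lt_of_lt (α := αᵒᵈ) f hab h

/-- A partition has a disconnected ladder iff there are `1 ≤ a < b` with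
`lam a - lam (a+1) ≥ 2` and `lam b = lam (b+1) > 0`. -/
theorem stmt0 (lam : ℕ → ℕ) (hlam : IsPartition lam) :
    (∃ l, 1 ≤ l ∧ LadderDisconnected lam l) ↔
      (∃ a b, 1 ≤ a ∧ a < b ∧ 2 ≤ lam a - lam (a + 1) ∧
        lam b = lam (b + 1) ∧ 0 < lam (b + 1)) := by
  constructor
  · rintro ⟨l, -, a, b, c, ha, hab, hbc, hcl, hA, hB, hC⟩
    simp only [diagram, Set.mem_ofPred_eq] at hA hB hC
    obtain ⟨i, hai, hib, hi⟩ :=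
      exists_succ_lt_of_lt (fun i => lam i + i) hab.le (by lia)
    obtain ⟨j, hbj, hjc, hj⟩ :=
      exists_lt_succ_of_lt (fun i => lam i + i) hbc.le (by lia)
    have hjj := hlam.1 j (by lia)
    have hjc' := hlam.le_of_le (i := j + 1) (by lia) hjc
    exact ⟨i, j, by lia, by lia, by lia, by lia, by lia⟩
  · rintro ⟨a, b, ha, hab, h2, hb, hpos⟩
    have hex : ∃ b, a < b ∧ lam b = lam (b + 1) ∧ 0 < lam (b + 1) := ⟨b, hab, hb, hpos⟩
    classical
    obtain ⟨m, ⟨ham, hm, hmpos⟩, hmin⟩ :=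
      (⟨Nat.find hex, Nat.find_spec hex, Nat.find_min hex⟩ :
        ∃ m, (a < m ∧ lam m = lam (m + 1) ∧ 0 < lam (m + 1)) ∧
          ∀ {j}, j < m → ¬(a < j ∧ lam j = lam (j + 1) ∧ 0 < lam (j + 1)))
    have hle : lam m + m ≤ lam (a + 1) + (a + 1) := by
      by_contra! hlt
      obtain ⟨j, haj, hjm, hj⟩ := exists_lt_succ_of_lt (fun i => lam i + i) ham hlt
      have hjj := hlam.1 j (by lia)
      have hjm' := hlam.le_of_le (i := j + 1) (by lia) hjm
      exact hmin hjm ⟨haj, by lia, by lia⟩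
    refine ⟨lam m + m, by lia, a, m, m + 1, ha, ham, by lia, by lia, ?_, ?_, ?_⟩ <;>
      simp only [diagram, Set.mem_ofPred_eq] <;> lia
end

section
/- For integers 0 ≤ b ≤ a, the Gaussian binomial coefficient [a choose b]_q evaluated at q = −1 equals the ordinary binomial coefficient C(⌊a/2⌋, ⌊b/2⌋) if a is odd or b is even, and equals 0 if a is even and b is odd. -/
open Polynomial

/-- The quantum integer `[m]_q = 1 + q + … + q^(m-1)` as a polynomial in `q` over `ℤ`. -/
noncomputable def qint (m : ℕ) : Polynomial ℤ := ∑ i ∈ Finset.range m, X ^ i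

/-- The quantum factorial `[m]!_q = [1]_q [2]_q ⋯ [m]_q`. -/
noncomputable def qfact (m : ℕ) : Polynomial ℤ := ∏ i ∈ Finset.range m, qint (i + 1)

/-- The Gaussian binomial coefficient, defined by the `q`-Pascal recursion. -/
noncomputable def gaussBinom : ℕ → ℕ → Polynomial ℤ
  | _, 0 => 1
  | 0, _ + 1 => 0
  | n + 1, k + 1 => gaussBinom n k + X ^ (k + 1) * gaussBinom n (k + 1)

theorem gaussBinom_zero_right (n : ℕ) : gaussBinom n 0 = 1 := by
  cases n <;> rfl

theorem gaussBinom_zero_succ (k : ℕ) : gaussBinom 0 (k + 1) = 0 := rfl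

theorem gaussBinom_succ_succ (n k : ℕ) :
    gaussBinom (n + 1) (k + 1) = gaussBinom n k + X ^ (k + 1) * gaussBinom n (k + 1) := rfl

theorem gaussBinom_eq_zero_of_lt {n k : ℕ} (h : n < k) : gaussBinom n k = 0 := by
  induction n generalizing k with
  | zero => obtain ⟨k, rfl⟩ := Nat.exists_eq_succ_of_ne_zero h.ne'; rfl
  | succ n ih =>
    obtain ⟨k, rfl⟩ := Nat.exists_eq_succ_of_ne_zero (Nat.ne_zero_of_lt h)
    rw [Nat.succ_eq_add_one, gaussBinom_succ_succ, ih (by omega), ih (by omega)]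
    simp

theorem gaussBinom_self (n : ℕ) : gaussBinom n n = 1 := by
  induction n with
  | zero => rfl
  | succ n ih => rw [gaussBinom_succ_succ, ih, gaussBinom_eq_zero_of_lt n.lt_succ_self]; simp

theorem qint_add (k m : ℕ) : qint (k + m) = qint k + X ^ k * qint m := by
  simp only [qint, Finset.sum_range_add, Finset.mul_sum, pow_add]

theorem qfact_zero : qfact 0 = 1 := rfl

theorem qfact_succ (m : ℕ) : qfact (m + 1) = qfact m * qint (m + 1) :=
  Finset.prod_range_succ _ _

theorem qint_succ_ne_zero (m : ℕ) : qint (m + 1) ≠ 0 := by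
  intro h
  have h1 := congrArg (Polynomial.eval 1) h
  simp only [qint, eval_finsetSum, eval_pow, eval_X, one_pow, Finset.sum_const,
    Finset.card_range, eval_zero, nsmul_eq_mul, mul_one] at h1
  exact Nat.cast_ne_zero.2 m.succ_ne_zero h1

theorem qfact_ne_zero (m : ℕ) : qfact m ≠ 0 :=
  Finset.prod_ne_zero_iff.2 fun i _ => qint_succ_ne_zero i

theorem gaussBinom_mul_qfact_mul_qfact (n k : ℕ) :
    gaussBinom (n + k) k * (qfact k * qfact n) = qfact (n + k) := by
  induction k generalizing n with
  | zero => simp [gaussBinom_zero_right, qfact_zero]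
  | succ k ihk =>
    induction n with
    | zero => simp [gaussBinom_self, qfact_zero]
    | succ n ihn =>
      have h1 := ihk (n + 1)
      rw [show n + 1 + k = n + (k + 1) by ring] at h1
      rw [show n + 1 + (k + 1) = n + (k + 1) + 1 by ring, gaussBinom_succ_succ,
        qfact_succ (n + (k + 1)), show n + (k + 1) + 1 = k + 1 + (n + 1) by ring, qint_add]
      rw [qfact_succ k] at ihn ⊢
      rw [qfact_succ n] at h1 ⊢
      linear_combination qint (k + 1) * h1 + X ^ (k + 1) * qint (n + 1) * ihn

theorem eval_neg_one_gaussBinom_succ_odd (n j : ℕ) :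
    (gaussBinom (n + 1) (2 * j + 1)).eval (-1) =
      (gaussBinom n (2 * j)).eval (-1) - (gaussBinom n (2 * j + 1)).eval (-1) := by
  have h : (-1 : ℤ) ^ (2 * j + 1) = -1 := Odd.neg_one_pow ⟨j, rfl⟩
  rw [gaussBinom_succ_succ, eval_add, eval_mul, eval_pow, eval_X, h]
  ring

theorem eval_neg_one_gaussBinom_succ_even (n j : ℕ) :
    (gaussBinom (n + 1) (2 * (j + 1))).eval (-1) =
      (gaussBinom n (2 * j + 1)).eval (-1) + (gaussBinom n (2 * (j + 1))).eval (-1) := by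
  have h : (-1 : ℤ) ^ (2 * j + 1 + 1) = 1 := Even.neg_one_pow ⟨j + 1, by ring⟩
  rw [show 2 * (j + 1) = 2 * j + 1 + 1 by ring, gaussBinom_succ_succ, eval_add, eval_mul,
    eval_pow, eval_X, h, one_mul]

theorem eval_neg_one_gaussBinom_odd_of_even {m : ℕ}
    (he : ∀ j, (gaussBinom (2 * m) (2 * j)).eval (-1) = m.choose j)
    (ho : ∀ j, (gaussBinom (2 * m) (2 * j + 1)).eval (-1) = 0) (j : ℕ) :
    (gaussBinom (2 * m + 1) (2 * j)).eval (-1) = m.choose j ∧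
      (gaussBinom (2 * m + 1) (2 * j + 1)).eval (-1) = m.choose j := by
  constructor
  · cases j with
    | zero => simp [gaussBinom_zero_right]
    | succ j => rw [eval_neg_one_gaussBinom_succ_even, he, ho, zero_add]
  · rw [eval_neg_one_gaussBinom_succ_odd, he, ho, sub_zero]

theorem eval_neg_one_gaussBinom_even (m : ℕ) :
    (∀ j, (gaussBinom (2 * m) (2 * j)).eval (-1) = m.choose j) ∧
      ∀ j, (gaussBinom (2 * m) (2 * j + 1)).eval (-1) = 0 := by
  induction m with
  | zero =>
    refine ⟨fun j => ?_, fun j => by simp [gaussBinom_zero_succ]⟩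
    cases j with
    | zero => simp [gaussBinom_zero_right]
    | succ j => simp [gaussBinom_eq_zero_of_lt]
  | succ m ih =>
    have h := eval_neg_one_gaussBinom_odd_of_even ih.1 ih.2
    rw [show 2 * (m + 1) = 2 * m + 1 + 1 by ring]
    refine ⟨fun j => ?_, fun j => ?_⟩
    · cases j with
      | zero => simp [gaussBinom_zero_right]
      | succ j =>
        rw [eval_neg_one_gaussBinom_succ_even, (h j).2, (h (j + 1)).1, Nat.choose_succ_succ]
        push_cast
        rfl
    · rw [eval_neg_one_gaussBinom_succ_odd, (h j).1, (h j).2, sub_self]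

theorem eval_neg_one_gaussBinom (n k : ℕ) :
    (gaussBinom n k).eval (-1) =
      if n % 2 = 1 ∨ k % 2 = 0 then ((n / 2).choose (k / 2) : ℤ) else 0 := by
  have h (m : ℕ) := eval_neg_one_gaussBinom_even m
  have h' (m : ℕ) := eval_neg_one_gaussBinom_odd_of_even (h m).1 (h m).2
  obtain ⟨m, rfl | rfl⟩ := n.even_or_odd' <;> obtain ⟨j, rfl | rfl⟩ := k.even_or_odd'
  · simp [(h m).1]
  · simp [(h m).2]
  · simp [(h' m j).1, show (2 * m + 1) / 2 = m by omega]
  · simp [(h' m j).2, show (2 * m + 1) / 2 = m by omega, show (2 * j + 1) / 2 = j by omega]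

/-- For `0 ≤ b ≤ a`, the Gaussian binomial coefficient `[a choose b]_q`, i.e. the
(unique) polynomial `P` with `P * [b]!_q * [a-b]!_q = [a]!_q`, evaluated at `q = -1`,
equals `C(⌊a/2⌋, ⌊b/2⌋)` if `a` is odd or `b` is even, and equals `0` if `a` is even
and `b` is odd. -/
theorem stmt1 (a b : ℕ) (hba : b ≤ a) (P : Polynomial ℤ)
    (hP : P * (qfact b * qfact (a - b)) = qfact a) :
    P.eval (-1) =
      if a % 2 = 1 ∨ b % 2 = 0 then ((a / 2).choose (b / 2) : ℤ) else 0 := by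
  have hG := gaussBinom_mul_qfact_mul_qfact (a - b) b
  rw [Nat.sub_add_cancel hba, ← hP] at hG
  rw [← mul_right_cancel₀ (mul_ne_zero (qfact_ne_zero b) (qfact_ne_zero (a - b))) hG,
    eval_neg_one_gaussBinom]
end

section
/- Suppose l ≥ 1 and λ is a partition that can be obtained from the staircase partition (l−1, l−2, …, 2, 1) by successively adding dominoes, with every intermediate stage a partition, and suppose λ_{l+1} = 0. Then λ_i ≡ i + l (mod 2) for all 1 ≤ i ≤ l; in particular λ is alternating, i.e. for every i ≥ 1 either λ_i + λ_{i+1} is odd or λ_{i+1} = 0. -/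
/-- A domino: a pair of horizontally or vertically adjacent nodes. -/
def IsDomino (s : Set (ℕ × ℕ)) : Prop :=
  (∃ i j, 1 ≤ i ∧ 1 ≤ j ∧ s = {(i, j), (i, j + 1)}) ∨
  (∃ i j, 1 ≤ i ∧ 1 ≤ j ∧ s = {(i, j), (i + 1, j)})

/-- The partition `mu` is obtained from the partition `nu` by adding a domino. -/
def DominoStep (nu mu : ℕ → ℕ) : Prop :=
  IsPartition nu ∧ IsPartition mu ∧ diagram nu ⊆ diagram mu ∧
    IsDomino (diagram mu \ diagram nu)

theorem IsPartition.le_of_le_s2 {lam : ℕ → ℕ} (h : IsPartition lam) {a b : ℕ} (ha : 1 ≤ a)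
    (hab : a ≤ b) : lam b ≤ lam a := by
  induction b, hab using Nat.le_induction with
  | base => exact le_rfl
  | succ n hn ih => exact (h.1 n (ha.trans hn)).trans ih

theorem diagram_subset_iff {nu mu : ℕ → ℕ} :
    diagram nu ⊆ diagram mu ↔ ∀ k, 1 ≤ k → nu k ≤ mu k := by
  constructor
  · intro h k hk
    rcases Nat.eq_zero_or_pos (nu k) with h0 | h0
    · omega
    · exact (h (show (k, nu k) ∈ diagram nu from ⟨hk, h0, le_rfl⟩)).2.2
  · rintro h ⟨k, m⟩ ⟨hk, hm, hle⟩
    exact ⟨hk, hm, hle.trans (h k hk)⟩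

theorem mem_diagram_diff_iff {nu mu : ℕ → ℕ} {k m : ℕ} (hk : 1 ≤ k) (hm : 1 ≤ m) :
    (k, m) ∈ diagram mu \ diagram nu ↔ nu k < m ∧ m ≤ mu k := by
  simp only [diagram, Set.mem_sdiff, Set.mem_ofPred_eq]
  omega

/-- Adding a domino either adds a horizontal one, so that every row length keeps its parity, or
adds a vertical one at the end of two consecutive rows of equal length. -/
theorem DominoStep.rows {nu mu : ℕ → ℕ} (h : DominoStep nu mu) :
    (∀ k, 1 ≤ k → mu k % 2 = nu k % 2) ∨
      ∃ i, 1 ≤ i ∧ nu i = nu (i + 1) ∧ 0 < mu (i + 1) := by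
  obtain ⟨-, -, hsub, hdom⟩ := h
  rw [diagram_subset_iff] at hsub
  rcases hdom with ⟨i, j, hi, hj, hs⟩ | ⟨i, j, hi, hj, hs⟩
  · left
    intro k hk
    have key : ∀ m, 1 ≤ m → ((nu k < m ∧ m ≤ mu k) ↔ (k = i ∧ (m = j ∨ m = j + 1))) := by
      intro m hm
      rw [← mem_diagram_diff_iff hk hm, hs]
      simp only [Set.mem_insert_iff, Set.mem_singleton_iff, Prod.mk.injEq]
      tauto
    have h₁ := hsub k hk
    have h₂ := key (nu k + 1) (by omega)
    have h₃ := key j hj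
    have h₄ := key (j + 1) (by omega)
    have h₅ := key (mu k)
    omega
  · right
    have key : ∀ k m, 1 ≤ k → 1 ≤ m →
        ((nu k < m ∧ m ≤ mu k) ↔ ((k = i ∨ k = i + 1) ∧ m = j)) := by
      intro k m hk hm
      rw [← mem_diagram_diff_iff hk hm, hs]
      simp only [Set.mem_insert_iff, Set.mem_singleton_iff, Prod.mk.injEq]
      tauto
    have h₁ := key i j hi hj
    have h₂ := key (i + 1) j (by omega) hj
    have h₃ := key i (nu i + 1) hi (by omega)
    have h₄ := key (i + 1) (nu (i + 1) + 1) (by omega) (by omega)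
    exact ⟨i, hi, by omega, by omega⟩

/-- If `lam` is obtained from the staircase `(l-1, l-2, …, 2, 1)` by successively
adding dominoes (every intermediate stage a partition), and `lam (l+1) = 0`, then
`lam i ≡ i + l (mod 2)` for `1 ≤ i ≤ l`; in particular `lam` is alternating. -/
theorem stmt2 (l : ℕ) (hl : 1 ≤ l) (lam : ℕ → ℕ)
    (hchain : Relation.ReflTransGen DominoStep (fun i => l - i) lam)
    (htop : lam (l + 1) = 0) :
    (∀ i, 1 ≤ i → i ≤ l → lam i % 2 = (i + l) % 2) ∧
    (∀ i, 1 ≤ i → (lam i + lam (i + 1)) % 2 = 1 ∨ lam (i + 1) = 0) := by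
  have parity : ∀ i, 1 ≤ i → i ≤ l → lam i % 2 = (i + l) % 2 := by
    induction hchain with
    | refl => intro i _ _; dsimp only; omega
    | @tail nu mu _ hstep ih =>
      have hle := diagram_subset_iff.1 hstep.2.2.1 (l + 1) (by omega)
      have ih := ih (by omega)
      rcases hstep.rows with hpar | ⟨i, hi, heq, hpos⟩
      · intro i hi hil
        rw [hpar i hi, ih i hi hil]
      · have hil : i + 1 ≤ l := by
          by_contra hcon
          have := hstep.2.1.le_of_le_s2 (a := l + 1) (b := i + 1) (by omega) (by omega)
          omega
        have h₁ := ih i hi (by omega)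
        have h₂ := ih (i + 1) (by omega) hil
        omega
  have hpart : IsPartition lam := by
    rcases hchain.cases_tail with rfl | ⟨nu, -, hstep⟩
    · exact ⟨fun i _ => by dsimp only; omega, l, fun i _ => by dsimp only; omega⟩
    · exact hstep.2.1
  refine ⟨parity, fun i hi => ?_⟩
  rcases Nat.lt_or_ge i l with hil | hil
  · have h₁ := parity i hi hil.le
    have h₂ := parity (i + 1) (by omega) hil
    omega
  · have := hpart.le_of_le_s2 (a := l + 1) (b := i + 1) (by omega) (by omega)
    omega
end

section
/- A partition λ is 2-regular if and only if for every l ≥ 1 there exists s ≥ 0 such that L_l(λ) = {(1,l), (2,l−1), …, (s, l+1−s)}, i.e. the nodes of λ in each ladder occupy the topmost positions of that ladder. -/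
/-- A partition is 2-regular if no two consecutive parts are equal and positive. -/
def TwoRegular (lam : ℕ → ℕ) : Prop :=
  ∀ i, 1 ≤ i → ¬(lam i = lam (i + 1) ∧ 0 < lam (i + 1))

/-- In a 2-regular partition, moving one step up a ladder stays inside the diagram. -/
theorem TwoRegular.ladder_step {lam : ℕ → ℕ} (hreg : TwoRegular lam) (hlam : IsPartition lam)
    {i j : ℕ} (hi : 1 ≤ i) (h : (i + 1, j) ∈ diagram lam) : (i, j + 1) ∈ diagram lam := by
  have h₁ := hreg i hi
  have h₂ := hlam.1 i hi
  simp only [diagram, Set.mem_ofPred_eq] at h ⊢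
  omega

/-- In a 2-regular partition, every position of a ladder above a node of the partition is
itself a node of the partition. -/
theorem TwoRegular.ladder_up {lam : ℕ → ℕ} (hreg : TwoRegular lam) (hlam : IsPartition lam)
    {i : ℕ} (hi : 1 ≤ i) (k j : ℕ) (h : (i + k, j) ∈ diagram lam) :
    (i, j + k) ∈ diagram lam := by
  induction k generalizing j with
  | zero => exact h
  | succ k ih =>
    have := ih (j + 1) (hreg.ladder_step hlam (by omega) h)
    rwa [show j + 1 + k = j + (k + 1) by omega] at this

/-- A partition is 2-regular iff for every `l ≥ 1` the nodes of `lam` in the `l`-th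
ladder occupy the topmost positions of that ladder, i.e. the `l`-th ladder of `lam`
is `{(1,l), (2,l-1), …, (s,l+1-s)}` for some `s ≥ 0`. -/
theorem stmt4 (lam : ℕ → ℕ) (hlam : IsPartition lam) :
    TwoRegular lam ↔
      ∀ l, 1 ≤ l → ∃ s : ℕ,
        {p : ℕ × ℕ | p ∈ diagram lam ∧ p.1 + p.2 = l + 1} =
          {p : ℕ × ℕ | 1 ≤ p.1 ∧ p.1 ≤ s ∧ p.2 = l + 1 - p.1} := by
  constructor
  · intro hreg l _
    classical
    let s := Nat.findGreatest (fun i => (i, l + 1 - i) ∈ diagram lam) l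
    refine ⟨s, ?_⟩
    ext ⟨a, b⟩
    simp only [Set.mem_ofPred_eq]
    constructor
    · rintro ⟨hab, hsum⟩
      have ha : 1 ≤ a := hab.1
      have hb : 1 ≤ b := hab.2.1
      have hb' : b = l + 1 - a := by omega
      refine ⟨ha, Nat.le_findGreatest (by omega) ?_, hb'⟩
      rwa [← hb']
    · rintro ⟨ha, has, rfl⟩
      have hsl : s ≤ l := Nat.findGreatest_le l
      have hs : (s, l + 1 - s) ∈ diagram lam :=
        Nat.findGreatest_of_ne_zero (P := fun i => (i, l + 1 - i) ∈ diagram lam) (n := l)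
          rfl (by omega)
      have := hreg.ladder_up hlam ha (s - a) (l + 1 - s) (by rwa [Nat.add_sub_cancel' has])
      rw [show l + 1 - s + (s - a) = l + 1 - a by omega] at this
      exact ⟨this, by omega⟩
  · rintro h i hi ⟨heq, hpos⟩
    obtain ⟨s, hs⟩ := h (i + lam (i + 1)) (by omega)
    have h₁ := Set.ext_iff.1 hs (i + 1, lam (i + 1))
    have h₂ := Set.ext_iff.1 hs (i, lam (i + 1) + 1)
    simp only [diagram, Set.mem_ofPred_eq] at h₁ h₂
    omega
end

section
/- For any partition λ, the set ⋃_{l ≥ 1} {(i, l+1−i) : 1 ≤ i ≤ |L_l(λ)|} — obtained by moving the nodes in each ladder of λ to the topmost positions in that ladder — is the Young diagram of a 2-regular partition (the regularisation λ^reg of λ). -/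
/-- The number of nodes of `lam` in the `l`-th ladder `L_l = {(i,j) : i+j = l+1}`. -/
noncomputable def ladderCard (lam : ℕ → ℕ) (l : ℕ) : ℕ :=
  {p : ℕ × ℕ | p ∈ diagram lam ∧ p.1 + p.2 = l + 1}.ncard

/-- The rows meeting the `l`-th ladder of `lam`. -/
def ladderRows (lam : ℕ → ℕ) (l : ℕ) : Finset ℕ :=
  {i ∈ Finset.Icc 1 l | l + 1 ≤ lam i + i}

theorem mem_ladderRows {lam : ℕ → ℕ} {l i : ℕ} :
    i ∈ ladderRows lam l ↔ (1 ≤ i ∧ i ≤ l) ∧ l + 1 ≤ lam i + i := by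
  simp [ladderRows]

theorem ladderCard_eq_card_ladderRows (lam : ℕ → ℕ) (l : ℕ) :
    ladderCard lam l = (ladderRows lam l).card := by
  have h : {p : ℕ × ℕ | p ∈ diagram lam ∧ p.1 + p.2 = l + 1} =
      (fun i => (i, l + 1 - i)) '' (ladderRows lam l : Set ℕ) := by
    ext ⟨i, j⟩
    simp only [diagram, Set.mem_ofPred_eq, Set.mem_image, Finset.mem_coe, mem_ladderRows,
      Prod.mk.injEq]
    constructor
    · rintro ⟨⟨hi, hj, hle⟩, hs⟩
      exact ⟨i, by omega, rfl, by omega⟩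
    · rintro ⟨k, hk, rfl, rfl⟩
      omega
  rw [ladderCard, h, Set.ncard_image_of_injective _ fun a b hab => congrArg Prod.fst hab,
    Set.ncard_coe_finset]

theorem ladderCard_le (lam : ℕ → ℕ) (l : ℕ) : ladderCard lam l ≤ l := by
  rw [ladderCard_eq_card_ladderRows]
  exact (Finset.card_filter_le _ _).trans (by simp)

/-- A ladder that is not full is at least as large as the next one. -/
theorem IsPartition.ladderCard_succ_le {lam : ℕ → ℕ} (hlam : IsPartition lam) {l : ℕ}
    (hl : ladderCard lam l < l) : ladderCard lam (l + 1) ≤ ladderCard lam l := by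
  rw [ladderCard_eq_card_ladderRows] at hl
  obtain ⟨a, ha, hal⟩ : ∃ a ∈ Finset.Icc 1 l, a ∉ ladderRows lam l :=
    Finset.exists_mem_notMem_of_card_lt_card (by simpa using hl)
  rw [Finset.mem_Icc] at ha
  simp only [mem_ladderRows, not_and, not_le] at hal
  have hal := hal ha
  have hgap : ∀ i ∈ ladderRows lam (l + 1), i < a ∨ a + 2 ≤ i := by
    intro i hi
    rw [mem_ladderRows] at hi
    by_contra! h
    obtain rfl | rfl : i = a ∨ i = a + 1 := by omega
    · omega
    · have := hlam.1 a ha.1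
      omega
  rw [ladderCard_eq_card_ladderRows, ladderCard_eq_card_ladderRows]
  refine Finset.card_le_card_of_injOn (fun i => if i < a then i else i - 1) ?_ ?_
  · intro i hi
    rw [Finset.mem_coe] at hi
    have hg := hgap i hi
    rw [mem_ladderRows] at hi
    simp only [Finset.mem_coe, mem_ladderRows]
    split_ifs with hia
    · omega
    · have := hlam.1 (i - 1) (by omega)
      rw [Nat.sub_add_cancel hi.1.1] at this
      omega
  · intro i hi k hk hik
    have hi := hgap i hi
    have hk := hgap k hk
    dsimp only at hik
    split_ifs at hik <;> omega

theorem IsPartition.exists_ladderCard_eq_zero {lam : ℕ → ℕ} (hlam : IsPartition lam) :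
    ∃ M, ∀ l, M ≤ l → ladderCard lam l = 0 := by
  obtain ⟨hanti, N, hN⟩ := hlam
  have hle : ∀ i, 1 ≤ i → lam i ≤ lam 1 := by
    intro i hi
    induction i, hi using Nat.le_induction with
    | base => exact le_rfl
    | succ i hi ih => exact (hanti i hi).trans ih
  refine ⟨lam 1 + N, fun l hl => ?_⟩
  rw [ladderCard_eq_card_ladderRows, Finset.card_eq_zero, Finset.eq_empty_iff_forall_notMem]
  intro i hi
  rw [mem_ladderRows] at hi
  have := hle i hi.1.1
  have := hN i
  omega

/-- Moving the nodes in each ladder of a partition `lam` to the topmost positions of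
that ladder yields the Young diagram of a 2-regular partition (the regularisation). -/
theorem stmt5 (lam : ℕ → ℕ) (hlam : IsPartition lam) :
    ∃ mu : ℕ → ℕ, IsPartition mu ∧ TwoRegular mu ∧
      diagram mu =
        {p : ℕ × ℕ | ∃ l, 1 ≤ l ∧ 1 ≤ p.1 ∧ p.1 ≤ ladderCard lam l ∧
          p.1 + p.2 = l + 1} := by
  obtain ⟨M, hM⟩ := hlam.exists_ladderCard_eq_zero
  have hbound : ∀ i j, 1 ≤ i → i ≤ ladderCard lam (i + j - 1) → i + j - 1 < M := by
    intro i j hi hij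
    by_contra! h
    have := hM _ h
    omega
  have hrow : ∀ i j, 1 ≤ i → 1 ≤ j → i ≤ ladderCard lam (i + (j + 1) - 1) →
      i ≤ ladderCard lam (i + j - 1) := by
    intro i j hi hj hij
    by_contra! h
    have := hlam.ladderCard_succ_le (l := i + j - 1) (by omega)
    rw [show i + j - 1 + 1 = i + (j + 1) - 1 by omega] at this
    omega
  let mu : ℕ → ℕ := fun i => Nat.findGreatest (fun j => i ≤ ladderCard lam (i + j - 1)) M
  have hmu : ∀ i j, 1 ≤ i → 1 ≤ j → (j ≤ mu i ↔ i ≤ ladderCard lam (i + j - 1)) := by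
    intro i j hi hj
    constructor
    · intro h
      have hspec : i ≤ ladderCard lam (i + mu i - 1) :=
        Nat.findGreatest_of_ne_zero (P := fun j => i ≤ ladderCard lam (i + j - 1)) rfl
          (by omega)
      exact Nat.decreasingInduction' (P := fun j => i ≤ ladderCard lam (i + j - 1))
        (fun k _ hk => hrow i k hi (by omega)) h hspec
    · intro h
      have := hbound i j hi h
      exact Nat.le_findGreatest (by omega) h
  have hstep : ∀ i, 1 ≤ i → 0 < mu (i + 1) → mu (i + 1) < mu i := by
    intro i hi hpos
    have h := (hmu (i + 1) (mu (i + 1)) (by omega) hpos).1 le_rfl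
    refine (hmu i (mu (i + 1) + 1) hi (by omega)).2 ?_
    rw [show i + 1 + mu (i + 1) - 1 = i + (mu (i + 1) + 1) - 1 by omega] at h
    omega
  refine ⟨mu, ⟨fun i hi => ?_, M + 1, fun i hi => ?_⟩, fun i hi h => ?_, ?_⟩
  · have := hstep i hi
    omega
  · by_contra h
    have := hbound i (mu i) (by omega) ((hmu i (mu i) (by omega) (by omega)).1 le_rfl)
    omega
  · have := hstep i hi h.2
    omega
  · ext ⟨i, j⟩
    simp only [diagram, Set.mem_ofPred_eq]
    constructor
    · rintro ⟨hi, hj, h⟩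
      exact ⟨i + j - 1, by omega, hi, (hmu i j hi hj).1 h, by omega⟩
    · rintro ⟨l, hl, hi, h, hs⟩
      have := ladderCard_le lam l
      have hj : 1 ≤ j := by omega
      obtain rfl : l = i + j - 1 := by omega
      exact ⟨hi, hj, (hmu i j hi hj).2 h⟩
end

section
/- Let λ be a partition and l ≥ 1 such that (1,l) ∈ [λ], (l,1) ∈ [λ], and the ladder L_l(λ) is disconnected. If λ has no addable node of residue l mod 2, then (1, l+1) ∈ [λ], (l+1, 1) ∈ [λ], and the ladder L_{l+1}(λ) is disconnected. -/
/-- The residue of the node `(i,j)`: `(j - i) mod 2`, an element of `{0, 1} ⊆ ℤ`. -/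
def res (i j : ℕ) : ℤ := ((j : ℤ) - (i : ℤ)) % 2

/-- `(i,j)` is an addable node of `lam`: it is not a node of `lam`, and adding it
gives the Young diagram of a partition. -/
def Addable (lam : ℕ → ℕ) (i j : ℕ) : Prop :=
  (i, j) ∉ diagram lam ∧
    ∃ mu : ℕ → ℕ, IsPartition mu ∧ diagram mu = diagram lam ∪ {(i, j)}

/-- `(i,j)` is a removable node of `lam`: it is a node of `lam`, and removing it
gives the Young diagram of a partition. -/
def Removable (lam : ℕ → ℕ) (i j : ℕ) : Prop :=
  (i, j) ∈ diagram lam ∧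
    ∃ mu : ℕ → ℕ, IsPartition mu ∧ diagram mu = diagram lam \ {(i, j)}

/-- `mu` is the partition `lam^{+x}` obtained from `lam` by adding all addable nodes
of residue `x`. -/
def AddAllOfRes (lam : ℕ → ℕ) (x : ℤ) (mu : ℕ → ℕ) : Prop :=
  IsPartition mu ∧
    diagram mu = diagram lam ∪ {p : ℕ × ℕ | Addable lam p.1 p.2 ∧ res p.1 p.2 = x}

/-- A row that is the first one, or strictly shorter than the row above it, can be extended
by an addable node. -/
theorem addable_of_lt {lam : ℕ → ℕ} (hlam : IsPartition lam) {i : ℕ} (hi : 1 ≤ i)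
    (h : ∀ k, 1 ≤ k → k + 1 = i → lam i < lam k) : Addable lam i (lam i + 1) := by
  obtain ⟨hmono, N, hN⟩ := hlam
  refine ⟨fun hmem => ?_, Function.update lam i (lam i + 1), ⟨fun k hk => ?_, N + i + 1, ?_⟩, ?_⟩
  · have := hmem.2.2
    dsimp only at this
    omega
  · have hm := hmono k hk
    have hlt := h k hk
    by_cases hki : k + 1 = i
    · subst hki
      simpa [Function.update] using hlt rfl
    · by_cases hk' : k = i
      · subst hk'
        simp only [Function.update_self, ne_eq, hki, not_false_eq_true, Function.update_of_ne]
        omega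
      · simpa [Function.update, hki, hk'] using hm
  · intro k hk
    rw [Function.update_of_ne (by omega)]
    exact hN k (by omega)
  · ext ⟨p, q⟩
    simp only [diagram, Set.mem_ofPred_eq, Set.mem_union, Set.mem_singleton_iff, Prod.mk.injEq]
    by_cases hp : p = i
    · subst hp
      simp only [Function.update_self, true_and]
      omega
    · simp [hp]

/-- Suppose `(1,l)` and `(l,1)` are nodes of `lam` and the `l`-th ladder of `lam` is
disconnected.  If `lam` has no addable node of residue `l % 2`, then `(1,l+1)` and
`(l+1,1)` are nodes of `lam` and the `(l+1)`-th ladder of `lam` is disconnected. -/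
theorem stmt7 (lam : ℕ → ℕ) (hlam : IsPartition lam) (l : ℕ) (hl : 1 ≤ l)
    (h1 : (1, l) ∈ diagram lam) (h2 : (l, 1) ∈ diagram lam)
    (hdis : LadderDisconnected lam l)
    (hnone : ∀ i j, Addable lam i j → res i j ≠ ((l % 2 : ℕ) : ℤ)) :
    (1, l + 1) ∈ diagram lam ∧ (l + 1, 1) ∈ diagram lam ∧
      LadderDisconnected lam (l + 1) := by
  have hfirst : l + 1 ≤ lam 1 := by
    by_contra! hlt
    have hl1 : lam 1 = l := by
      have := h1.2.2
      dsimp only at this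
      omega
    refine hnone 1 (lam 1 + 1) (addable_of_lt hlam le_rfl (by omega)) ?_
    rw [hl1, res]
    omega
  have hlast : 1 ≤ lam (l + 1) := by
    by_contra! hlt
    have hl0 : lam (l + 1) = 0 := by omega
    refine hnone (l + 1) (lam (l + 1) + 1) (addable_of_lt hlam (by omega) ?_) ?_
    · intro k _ hkl
      obtain rfl : k = l := by omega
      have := h2.2.2
      dsimp only at this
      omega
    · rw [hl0, res]
      omega
  have hfirst_mem : (1, l + 1) ∈ diagram lam := ⟨le_rfl, by simp, hfirst⟩
  have hlast_mem : (l + 1, 1) ∈ diagram lam := ⟨by simp, le_rfl, hlast⟩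
  obtain ⟨a, b, c, ha, hab, hbc, hc, -, hb, -⟩ := hdis
  refine ⟨hfirst_mem, hlast_mem, 1, b, l + 1, le_rfl, by omega, by omega, le_rfl,
    by simpa using hfirst_mem, fun hmem => hb ?_, by simpa using hlast_mem⟩
  obtain ⟨hb1, hb2, hb3⟩ := hmem
  dsimp only at hb1 hb2 hb3
  exact ⟨hb1, by dsimp only; omega, by dsimp only; omega⟩
end

section
/- Let λ be a partition, l ≥ 1, j = (l+1) mod 2, and suppose 3 ≤ i ≤ l−1 is such that (i, l+1−i) ∈ [λ] but neither (i−1, l+2−i) nor (i+1, l−i) lies in [λ]. Then (i, l+1−i) is a removable node both of λ and of λ^{+(1−j)}. If moreover (1, l) ∈ [λ], then, writing μ = λ^{+(1−j)}, the addable node (1, μ_1 + 1) of μ has residue j and lies in the ladder L_m with m = μ_1 + 1 > l. -/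
theorem mem_diagram {lam : ℕ → ℕ} {r c : ℕ} :
    (r, c) ∈ diagram lam ↔ 1 ≤ r ∧ 1 ≤ c ∧ c ≤ lam r :=
  Iff.rfl

theorem removable_of_lt {lam : ℕ → ℕ} (h : IsPartition lam) {r : ℕ} (hr : 1 ≤ r)
    (hlt : lam (r + 1) < lam r) : Removable lam r (lam r) := by
  obtain ⟨hmono, N, hN⟩ := h
  refine ⟨⟨hr, by lia, le_rfl⟩, fun k ↦ if k = r then lam r - 1 else lam k,
    ⟨fun k hk ↦ ?_, N, fun k hk ↦ ?_⟩, ?_⟩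
  · have := hmono k hk
    grind
  · have := hN k hk
    grind
  · ext ⟨a, b⟩
    simp only [mem_diagram, Set.mem_sdiff, Set.mem_singleton_iff, Prod.mk.injEq]
    grind

theorem addable_first_row {lam : ℕ → ℕ} (h : IsPartition lam) :
    Addable lam 1 (lam 1 + 1) := by
  obtain ⟨hmono, N, hN⟩ := h
  refine ⟨fun hmem ↦ absurd (mem_diagram.1 hmem).2.2 (by lia),
    fun k ↦ if k = 1 then lam 1 + 1 else lam k,
    ⟨fun k hk ↦ ?_, N + 2, fun k hk ↦ ?_⟩, ?_⟩
  · have := hmono k hk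
    grind
  · have := hN k (by lia)
    grind
  · ext ⟨a, b⟩
    simp only [mem_diagram, Set.mem_union, Set.mem_singleton_iff, Prod.mk.injEq]
    grind

theorem Addable.eq_add_one {lam : ℕ → ℕ} {r c : ℕ} (h : Addable lam r c) :
    c = lam r + 1 := by
  obtain ⟨hnot, nu, -, hnu⟩ := h
  have hmem (a b : ℕ) : (a, b) ∈ diagram nu ↔ (a, b) ∈ diagram lam ∨ (a, b) = (r, c) := by
    rw [hnu]
    rfl
  simp only [mem_diagram, Prod.mk.injEq] at hmem hnot
  have h₁ := hmem r c
  have h₂ := hmem r (lam r + 1)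
  grind

theorem Addable.lt_of_succ {lam : ℕ → ℕ} {r c : ℕ} (hr : 1 ≤ r)
    (h : Addable lam (r + 1) c) : lam (r + 1) < lam r := by
  have hc := h.eq_add_one
  obtain ⟨-, nu, hpart, hnu⟩ := h
  have hmem (a b : ℕ) :
      (a, b) ∈ diagram nu ↔ (a, b) ∈ diagram lam ∨ (a, b) = (r + 1, c) := by
    rw [hnu]
    rfl
  simp only [mem_diagram, Prod.mk.injEq] at hmem
  have h₁ := hmem (r + 1) c
  have h₂ := hmem r c
  have h₃ := hpart.1 r hr
  grind

/-- Row by row, `lam^{+x}` extends row `r` by one node exactly when the node at its end is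
addable of residue `x`. -/
theorem AddAllOfRes.row_eq {lam mu : ℕ → ℕ} {x : ℤ} (h : AddAllOfRes lam x mu) {r : ℕ}
    (hr : 1 ≤ r) :
    (Addable lam r (lam r + 1) ∧ res r (lam r + 1) = x ∧ mu r = lam r + 1) ∨
      (¬ (Addable lam r (lam r + 1) ∧ res r (lam r + 1) = x) ∧ mu r = lam r) := by
  have hmem (c : ℕ) : (r, c) ∈ diagram mu ↔
      (r, c) ∈ diagram lam ∨ (Addable lam r c ∧ res r c = x) := by
    rw [h.2]
    rfl
  simp only [mem_diagram] at hmem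
  have h₁ := hmem (lam r)
  have h₂ := hmem (lam r + 1)
  have h₃ := hmem (mu r)
  have h₄ : Addable lam r (mu r) → mu r = lam r + 1 := Addable.eq_add_one
  have h₅ : Addable lam r (lam r) → lam r = lam r + 1 := Addable.eq_add_one
  grind

/-- Let `j = (l+1) % 2` and `3 ≤ i ≤ l-1`, with `(i, l+1-i)` a node of `lam` but
neither `(i-1, l+2-i)` nor `(i+1, l-i)` a node of `lam`.  Then `(i, l+1-i)` is a
removable node of both `lam` and `mu = lam^{+(1-j)}`; and if moreover `(1,l)` is a
node of `lam`, then the addable node `(1, mu 1 + 1)` of `mu` has residue `j` and lies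
in the ladder `L_m` with `m = mu 1 + 1 > l`. -/
theorem stmt8 (lam : ℕ → ℕ) (hlam : IsPartition lam) (l i : ℕ) (hl : 1 ≤ l)
    (hi3 : 3 ≤ i) (hil : i ≤ l - 1)
    (hin : (i, l + 1 - i) ∈ diagram lam)
    (hup : (i - 1, l + 2 - i) ∉ diagram lam)
    (hdown : (i + 1, l - i) ∉ diagram lam)
    (mu : ℕ → ℕ)
    (hmu : AddAllOfRes lam (1 - (((l + 1) % 2 : ℕ) : ℤ)) mu) :
    Removable lam i (l + 1 - i) ∧ Removable mu i (l + 1 - i) ∧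
      ((1, l) ∈ diagram lam →
        Addable mu 1 (mu 1 + 1) ∧
        res 1 (mu 1 + 1) = (((l + 1) % 2 : ℕ) : ℤ) ∧
        l < mu 1 + 1) := by
  obtain ⟨b, rfl⟩ : ∃ b, l = i + b := ⟨l - i, by lia⟩
  obtain ⟨k, rfl⟩ : ∃ k, i = k + 1 := ⟨i - 1, by lia⟩
  have hcol : k + 1 + b + 1 - (k + 1) = b + 1 := by lia
  rw [hcol] at hin ⊢
  simp only [mem_diagram] at hin hup hdown
  have hk : lam (k + 1) ≤ lam k := hlam.1 k (by lia)
  have hprev : lam k ≤ b + 1 := by grind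
  have hrow : lam (k + 1) = b + 1 := by lia
  have hnext : lam (k + 1 + 1) < b := by grind
  have hmu_row : mu (k + 1) = b + 1 := by
    rcases hmu.row_eq (r := k + 1) (by lia) with ⟨hadd, -⟩ | ⟨-, h⟩
    · have := hadd.lt_of_succ (by lia)
      lia
    · lia
  have hmu_next : mu (k + 1 + 1) < b + 1 := by
    rcases hmu.row_eq (r := k + 1 + 1) (by lia) with ⟨-, -, h⟩ | ⟨-, h⟩ <;> lia
  refine ⟨hrow ▸ removable_of_lt hlam (by lia) (by lia),
    hmu_row ▸ removable_of_lt hmu.1 (by lia) (by lia), fun hfirst ↦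
      ⟨addable_first_row hmu.1, ?_⟩⟩
  have hlen := (mem_diagram.1 hfirst).2.2
  have hadd := addable_first_row hlam
  rcases hmu.row_eq (r := 1) le_rfl with ⟨-, hres, h⟩ | ⟨hres, h⟩
  · simp only [res] at hres ⊢
    lia
  · rw [not_and] at hres
    replace hres := hres hadd
    simp only [res] at hres ⊢
    lia
end

section
/- Let λ be a partition, l ≥ 1, j = (l+1) mod 2, s ≥ 2, and 3 ≤ i ≤ l−s. Suppose the nodes (i, l+1−i), (i+1, l−i), …, (i+s−1, l+2−i−s) all lie in [λ], but neither (i−1, l+2−i) nor (i+s, l+1−i−s) lies in [λ]. Then, writing λ⁺ = λ^{+(1−j)}: the nodes (i+1, l+1−i), (i+2, l−i), …, (i+s−1, l+3−i−s) all lie in [λ⁺], while neither (i, l+2−i) nor (i+s, l+2−i−s) lies in [λ⁺]. -/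
theorem addable_of_eq {lam : ℕ → ℕ} (hlam : IsPartition lam) {a c : ℕ} (ha : 1 ≤ a)
    (hc : lam (a + 1) = c) (habove : c + 1 ≤ lam a) : Addable lam (a + 1) (c + 1) := by
  obtain ⟨hanti, N, hN⟩ := hlam
  refine ⟨fun h => ?_, Function.update lam (a + 1) (c + 1), ⟨fun i hi => ?_, N + a + 2, ?_⟩, ?_⟩
  · have h' : c + 1 ≤ lam (a + 1) := h.2.2
    omega
  · have := hanti i hi
    by_cases h1 : i = a
    · subst h1
      simpa using habove
    · by_cases h2 : i = a + 1
      · subst h2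
        simp only [Function.update_self]
        rw [Function.update_of_ne (by omega)]
        omega
      · rw [Function.update_of_ne (by omega), Function.update_of_ne h2]
        exact this
  · intro i hi
    rw [Function.update_of_ne (by omega)]
    exact hN i (by omega)
  · ext ⟨x, y⟩
    simp only [diagram, Set.mem_ofPred_eq, Set.mem_union, Set.mem_singleton_iff, Prod.mk.injEq]
    by_cases hx : x = a + 1
    · subst hx
      simp only [Function.update_self, true_and]
      omega
    · simp [hx]

theorem mem_diagram_of_addAllOfRes_of_res_ne {lam mu : ℕ → ℕ} {x : ℤ}
    (hmu : AddAllOfRes lam x mu) {a c : ℕ} (h : (a, c) ∈ diagram mu) (hres : res a c ≠ x) :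
    (a, c) ∈ diagram lam := by
  rw [hmu.2] at h
  exact h.resolve_right fun h' => hres h'.2

/-- Let `j = (l+1) % 2`, `s ≥ 2`, `3 ≤ i ≤ l-s`.  Suppose the nodes
`(i, l+1-i), (i+1, l-i), …, (i+s-1, l+2-i-s)` all lie in `[lam]`, but neither
`(i-1, l+2-i)` nor `(i+s, l+1-i-s)` lies in `[lam]`.  Then for `mu = lam^{+(1-j)}`:
the nodes `(i+1, l+1-i), …, (i+s-1, l+3-i-s)` all lie in `[mu]`, while neither
`(i, l+2-i)` nor `(i+s, l+2-i-s)` lies in `[mu]`. -/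
theorem stmt9 (lam : ℕ → ℕ) (hlam : IsPartition lam) (l i s : ℕ) (hl : 1 ≤ l)
    (hs : 2 ≤ s) (hi3 : 3 ≤ i) (his : i ≤ l - s)
    (hseg : ∀ t, t < s → (i + t, l + 1 - i - t) ∈ diagram lam)
    (hup : (i - 1, l + 2 - i) ∉ diagram lam)
    (hdown : (i + s, l + 1 - i - s) ∉ diagram lam)
    (mu : ℕ → ℕ)
    (hmu : AddAllOfRes lam (1 - (((l + 1) % 2 : ℕ) : ℤ)) mu) :
    (∀ t, 1 ≤ t → t ≤ s - 1 → (i + t, l + 2 - i - t) ∈ diagram mu) ∧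
      (i, l + 2 - i) ∉ diagram mu ∧ (i + s, l + 2 - i - s) ∉ diagram mu := by
  have hres : ∀ a c : ℕ, a + c = l + 2 → res a c = 1 - (((l + 1) % 2 : ℕ) : ℤ) := by
    intro a c h
    unfold res
    omega
  have hres' : ∀ a c : ℕ, a + c = l + 1 → res a c ≠ 1 - (((l + 1) % 2 : ℕ) : ℤ) := by
    intro a c h
    unfold res
    omega
  refine ⟨fun t ht1 hts => ?_, fun h => hup ?_, fun h => hdown ?_⟩
  · obtain ⟨u, rfl⟩ : ∃ u, t = u + 1 := ⟨t - 1, by omega⟩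
    obtain ⟨c, hc⟩ : ∃ c, l + 2 - i - (u + 1) = c + 1 := ⟨l - i - u, by omega⟩
    have habove : l + 1 - i - u ≤ lam (i + u) := (hseg u (by omega)).2.2
    have hleft : l + 1 - i - (u + 1) ≤ lam (i + u + 1) := (hseg (u + 1) (by omega)).2.2
    rw [hmu.2, hc, ← add_assoc]
    by_cases hmem : c + 1 ≤ lam (i + u + 1)
    · exact Or.inl ⟨by simp, by simp, hmem⟩
    · exact Or.inr ⟨addable_of_eq hlam (by omega) (by omega) (by omega),
        hres _ _ (by dsimp only; omega)⟩
  · refine mem_diagram_of_addAllOfRes_of_res_ne hmu ?_ (hres' _ _ (by omega))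
    have hle := hmu.1.1 (i - 1) (by omega)
    rw [Nat.sub_add_cancel (by omega)] at hle
    exact ⟨by dsimp only; omega, h.2.1, h.2.2.trans hle⟩
  · refine mem_diagram_of_addAllOfRes_of_res_ne hmu ?_ (hres' _ _ (by omega))
    have hle : l + 2 - i - s ≤ mu (i + s) := h.2.2
    exact ⟨h.1, by dsimp only; omega, by dsimp only; omega⟩
end

section
/- Let λ be a partition with exactly l nonzero parts, satisfying λ_i ≥ l − i + 2 for 1 ≤ i ≤ l. Suppose that the ladder L_k(λ) is not disconnected for every 1 ≤ k ≤ λ_1, but that some ladder of λ is disconnected; let m be minimal such that L_m(λ) is disconnected, and choose i such that (i−1, m+2−i) ∈ [λ], (i, m+1−i) ∉ [λ], and (k, m+1−k) ∈ [λ] for some k > i. Define partitions μ and μ̂ by: μ_r = l+2−r for 1 ≤ r ≤ l; μ̂_r = l+2−r for 1 ≤ r ≤ i−1 and μ̂_r = l−r for i ≤ r ≤ l (all other parts zero). For (k,h) ∈ [λ] set T(k,h) = max(0, h − μ_k) and T̂(k,h) = max(0, h − μ̂_k). Define N = Σ_{(k,h) ∈ [λ]} ( #{r < k : T(r, λ_r)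 < T(k,h) and T(r, λ_r) ≢ T(k,h) (mod 2)} − #{r < k : T(r, λ_r) < T(k,h) and T(r, λ_r) ≡ T(k,h) (mod 2)} ), and define N̂ by the same formula with T replaced by T̂ throughout. Then N̂ > N. -/
/-- The entry of the filling `T` at the node `(k,h)`: `max (0, h - mu k)`
(natural-number subtraction). -/
def Tof (mu : ℕ → ℕ) (k h : ℕ) : ℕ := h - mu k

/-- `N = Σ_{(k,h) ∈ [lam]} ( #{r < k : T(r, lam r) < T(k,h), opposite parity}
                            − #{r < k : T(r, lam r) < T(k,h), same parity} )`,
where the rows of `[lam]` are `1, …, l`. -/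
def Nof (lam mu : ℕ → ℕ) (l : ℕ) : ℤ :=
  ∑ k ∈ Finset.Icc 1 l, ∑ h ∈ Finset.Icc 1 (lam k),
    ((((Finset.Ico 1 k).filter fun r =>
        Tof mu r (lam r) < Tof mu k h ∧
          ¬Tof mu r (lam r) % 2 = Tof mu k h % 2).card : ℤ) -
      (((Finset.Ico 1 k).filter fun r =>
        Tof mu r (lam r) < Tof mu k h ∧
          Tof mu r (lam r) % 2 = Tof mu k h % 2).card : ℤ))

/-- In a row of length `n` the signed contributions relative to the value `t` telescope. -/
lemma sum_signed_indicator (t c n : ℕ) :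
    ∑ h ∈ Finset.Icc 1 n,
      ((if t < h - c ∧ ¬t % 2 = (h - c) % 2 then (1 : ℤ) else 0) -
        (if t < h - c ∧ t % 2 = (h - c) % 2 then (1 : ℤ) else 0)) =
      if t < n - c ∧ ¬t % 2 = (n - c) % 2 then 1 else 0 := by
  induction n with
  | zero => simp
  | succ n ih =>
    rw [Finset.sum_Icc_succ_top (by omega), ih]
    split_ifs <;> omega

/-- `Nof` counts the pairs of rows `r < k` whose last entries have odd difference, the
entry of row `k` being the larger one. -/
lemma Nof_eq_sum_pairs (lam mu : ℕ → ℕ) (l : ℕ) :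
    Nof lam mu l = ∑ k ∈ Finset.Icc 1 l, ∑ r ∈ Finset.Ico 1 k,
      if lam r - mu r < lam k - mu k ∧ ¬(lam r - mu r) % 2 = (lam k - mu k) % 2
        then (1 : ℤ) else 0 := by
  unfold Nof Tof
  refine Finset.sum_congr rfl fun k _ => ?_
  simp only [Finset.card_filter, Nat.cast_sum, Nat.cast_ite, Nat.cast_one, Nat.cast_zero,
    ← Finset.sum_sub_distrib]
  rw [Finset.sum_comm]
  exact Finset.sum_congr rfl fun r _ => sum_signed_indicator _ _ _

/-- Discrete intermediate value property: an integer sequence increasing by at most one at each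
step takes every value between two of its values. -/
lemma exists_eq_of_succ_le (a : ℕ → ℕ) (ha : ∀ r, 1 ≤ r → a (r + 1) ≤ a r + 1) (v n : ℕ)
    (hn : 1 ≤ n) (h1 : a 1 ≤ v) (hv : v ≤ a n) : ∃ r, 1 ≤ r ∧ r ≤ n ∧ a r = v := by
  induction n, hn using Nat.le_induction with
  | base => exact ⟨1, le_rfl, le_rfl, by omega⟩
  | succ n hn ih =>
    by_cases h : v ≤ a n
    · obtain ⟨r, hr1, hrn, hr⟩ := ih h
      exact ⟨r, hr1, by omega, hr⟩
    · exact ⟨n + 1, by omega, le_rfl, by have := ha n hn; omega⟩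

/-- With `lam` having exactly `l` nonzero parts, `lam i ≥ l - i + 2` for `1 ≤ i ≤ l`,
all ladders `L_k(lam)` with `k ≤ lam 1` connected, `m` minimal with `L_m(lam)`
disconnected, and `i` chosen with `(i-1, m+2-i) ∈ [lam]`, `(i, m+1-i) ∉ [lam]` and
`(k, m+1-k) ∈ [lam]` for some `k > i`: taking `μ = (l+1, l, …, 2)` and
`μ̂ = (l+1, l, …, l-i+3, l-i, l-i-1, …, 2, 1)`, we have `N̂ > N`. -/
theorem stmt12 (lam : ℕ → ℕ) (hlam : IsPartition lam) (l m i : ℕ)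
    (hparts : ∀ r, 1 ≤ r → (0 < lam r ↔ r ≤ l))
    (hbig : ∀ r, 1 ≤ r → r ≤ l → l - r + 2 ≤ lam r)
    (hconn : ∀ k, 1 ≤ k → k ≤ lam 1 → ¬LadderDisconnected lam k)
    (hm : LadderDisconnected lam m)
    (hmin : ∀ k, k < m → ¬LadderDisconnected lam k)
    (hi1 : (i - 1, m + 2 - i) ∈ diagram lam)
    (hi2 : (i, m + 1 - i) ∉ diagram lam)
    (hi3 : ∃ k, i < k ∧ (k, m + 1 - k) ∈ diagram lam) :
    Nof lam (fun r => if r ≤ l then l + 2 - r else 0) l <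
      Nof lam
        (fun r => if r ≤ i - 1 then l + 2 - r else if r ≤ l then l - r else 0)
        l := by
  obtain ⟨k, hik, hk⟩ := hi3
  simp only [diagram, Set.mem_ofPred_eq] at hi1 hi2 hk
  have hkl : k ≤ l := (hparts k hk.1).1 (by omega)
  have hbi := hbig i (by omega) (by omega)
  have hm1 : lam 1 < m := by
    by_contra h
    exact hconn m (by omega) (by omega) hm
  have hai : lam i + i = m := by
    by_contra h
    refine hmin (m - 1) (by omega) ⟨i - 1, i, k, ?_⟩
    simp only [diagram, Set.mem_ofPred_eq]
    omega
  obtain ⟨r, hr1, hri, hr⟩ := exists_eq_of_succ_le (fun r => lam r + r)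
    (fun r h => by have := hlam.1 r h; omega) (m + 1) (i - 1) hi1.1
    (by omega) (by omega)
  rw [Nof_eq_sum_pairs, Nof_eq_sum_pairs]
  have hle : ∀ k ∈ Finset.Icc 1 l, ∀ r ∈ Finset.Ico 1 k,
      (lam r - (if r ≤ l then l + 2 - r else 0) < lam k - (if k ≤ l then l + 2 - k else 0) ∧
        ¬(lam r - (if r ≤ l then l + 2 - r else 0)) % 2 =
          (lam k - (if k ≤ l then l + 2 - k else 0)) % 2) →
      (lam r - (if r ≤ i - 1 then l + 2 - r else if r ≤ l then l - r else 0) <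
          lam k - (if k ≤ i - 1 then l + 2 - k else if k ≤ l then l - k else 0) ∧
        ¬(lam r - (if r ≤ i - 1 then l + 2 - r else if r ≤ l then l - r else 0)) % 2 =
          (lam k - (if k ≤ i - 1 then l + 2 - k else if k ≤ l then l - k else 0)) % 2) := by
    intro k hk r hr
    rw [Finset.mem_Icc] at hk
    rw [Finset.mem_Ico] at hr
    have hbk := hbig k hk.1 hk.2
    have hbr := hbig r hr.1 (by omega)
    split_ifs <;> omega
  have hterm : ∀ (p q : Prop) [Decidable p] [Decidable q], (p → q) →
      (if p then (1 : ℤ) else 0) ≤ if q then 1 else 0 := by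
    intro p q _ _ h
    split_ifs <;> simp_all
  have hbr := hbig r hr1 (by omega)
  refine Finset.sum_lt_sum
    (fun k hk => Finset.sum_le_sum fun r hr => hterm _ _ (hle k hk r hr))
    ⟨i, Finset.mem_Icc.2 (by omega), Finset.sum_lt_sum
      (fun r hr => hterm _ _ (hle i (Finset.mem_Icc.2 (by omega)) r hr))
      ⟨r, Finset.mem_Ico.2 (by omega), ?_⟩⟩
  rw [if_neg, if_pos]
  · norm_num
  · rw [if_pos hri, if_neg (by omega), if_pos (by omega)]
    omega
  · rw [if_pos (by omega), if_pos (by omega)]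
    omega
end

section
/- Let l ≥ 0, let ν = (l, l−1, …, 2, 1) be the staircase partition, and let λ be a partition obtained from ν by successively adding w dominoes (every intermediate stage being a partition), where w ≤ l + 1. Then the skew diagram [λ] \ [ν] can be partitioned into dominoes in exactly one way. -/
/-- `lam` is obtained from `nu` by successively adding `w` dominoes, every
intermediate stage being a partition. -/
def ObtainedBy (nu : ℕ → ℕ) (w : ℕ) (lam : ℕ → ℕ) : Prop :=
  ∃ f : ℕ → ℕ → ℕ, f 0 = nu ∧ f w = lam ∧
    ∀ j, j < w → DominoStep (f j) (f (j + 1))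

/-- A diagram `S` containing the staircase `(l, …, 1)`, whose nodes off the staircase lie in the
first `a` rows or the first `b` columns.  The former rows have even length outside the staircase,
and so do the latter columns. -/
structure IsSplit (l a b : ℕ) (S : ℕ → ℕ → Prop) : Prop where
  pos : ∀ i j, S i j → 1 ≤ i ∧ 1 ≤ j
  down : ∀ i j i' j', S i j → 1 ≤ i' → i' ≤ i → 1 ≤ j' → j' ≤ j → S i' j'
  stair : ∀ i j, 1 ≤ i → 1 ≤ j → i + j ≤ l + 1 → S i j
  cover : ∀ i j, S i j → l + 2 ≤ i + j → i ≤ a ∨ j ≤ b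
  row : ∀ i j, i ≤ a → l + 2 ≤ i + j → (i + j + l) % 2 = 0 → S i j → S i (j + 1)
  col : ∀ i j, j ≤ b → l + 2 ≤ i + j → (i + j + l) % 2 = 0 → S i j → S (i + 1) j

theorem IsSplit.swap {l a b : ℕ} {S : ℕ → ℕ → Prop} (h : IsSplit l a b S) :
    IsSplit l b a (fun i j => S j i) where
  pos i j hs := (h.pos j i hs).symm
  down i j i' j' hs h1 h2 h3 h4 := h.down j i j' i' hs h3 h4 h1 h2
  stair i j h1 h2 h3 := h.stair j i h2 h1 (by omega)
  cover i j hs hl := (h.cover j i hs (by omega)).symm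
  row i j ha hl hp hs := h.col j i ha (by omega) (by omega) hs
  col i j ha hl hp hs := h.row j i ha (by omega) (by omega) hs

theorem IsSplit.add_horizontal {l a b : ℕ} {S S' : ℕ → ℕ → Prop} (h : IsSplit l a b S)
    (hab : a + b ≤ l)
    (pos : ∀ i j, S' i j → 1 ≤ i ∧ 1 ≤ j)
    (down : ∀ i j i' j', S' i j → 1 ≤ i' → i' ≤ i → 1 ≤ j' → j' ≤ j → S' i' j')
    (i j : ℕ) (hn : ¬ S i j) (hn' : ¬ S i (j + 1))
    (hS : ∀ p q, S' p q ↔ S p q ∨ (p = i ∧ q = j) ∨ (p = i ∧ q = j + 1)) :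
    ∃ a' b', a' + b' ≤ a + b + 1 ∧ IsSplit l a' b' S' := by
  have hij : S' i j := (hS i j).2 (by simp)
  have hij' : S' i (j + 1) := (hS i (j + 1)).2 (by simp)
  obtain ⟨hi, hj⟩ := pos _ _ hij
  have hl : l + 2 ≤ i + j := by
    by_contra hc
    exact hn (h.stair i j hi hj (by omega))
  have left : 2 ≤ j → S i (j - 1) := fun h2 => by
    have := (hS _ _).1 (down i j i (j - 1) hij hi le_rfl (by omega) (by omega))
    rcases this with h | h | h
    · exact h
    all_goals omega
  have up : 2 ≤ i → S (i - 1) j := fun h2 => by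
    have := (hS _ _).1 (down i j (i - 1) j hij (by omega) (by omega) hj le_rfl)
    rcases this with h | h | h
    · exact h
    all_goals omega
  have up' : 2 ≤ i → S (i - 1) (j + 1) := fun h2 => by
    have := (hS _ _).1 (down i (j + 1) (i - 1) (j + 1) hij' (by omega) (by omega) (by omega) le_rfl)
    rcases this with h | h | h
    · exact h
    all_goals omega
  have stair' : ∀ i j, 1 ≤ i → 1 ≤ j → i + j ≤ l + 1 → S' i j := fun p q h1 h2 h3 =>
    (hS p q).2 (Or.inl (h.stair p q h1 h2 h3))
  by_cases hia : i ≤ a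
  · have hpar : (i + j + l) % 2 = 0 := by
      by_contra hc
      have := h.row i (j - 1) hia (by omega) (by omega) (left (by omega))
      rw [Nat.sub_add_cancel hj] at this
      exact hn this
    refine ⟨a, b, by omega, pos, down, stair', ?_, ?_, ?_⟩
    · intro p q hs hpq
      rcases (hS p q).1 hs with h1 | h1 | h1
      · exact h.cover p q h1 hpq
      all_goals omega
    · intro p q hp hpq hpar' hs
      rcases (hS p q).1 hs with h1 | h1 | h1
      · exact (hS _ _).2 (Or.inl (h.row p q hp hpq hpar' h1))
      · rw [h1.1, h1.2]; exact hij'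
      · omega
    · intro p q hq hpq hpar' hs
      rcases (hS p q).1 hs with h1 | h1 | h1
      · exact (hS _ _).2 (Or.inl (h.col p q hq hpq hpar' h1))
      all_goals omega
  · have hjb : b < j := by
      by_contra hc
      by_cases hpar : (i + j + l) % 2 = 0
      · have h1 := up' (by omega)
        rcases h.cover _ _ h1 (by omega) with h2 | h2
        · omega
        · have := h.col (i - 1) (j + 1) h2 (by omega) (by omega) h1
          rw [Nat.sub_add_cancel hi] at this
          exact hn' this
      · have := h.col (i - 1) j (by omega) (by omega) (by omega) (up (by omega))
        rw [Nat.sub_add_cancel hi] at this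
        exact hn this
    have hsum : i + j = l + 2 := by
      by_contra hc
      have hj1 : j = b + 1 := by
        by_cases h2 : 2 ≤ j
        · have := h.cover _ _ (left h2) (by omega)
          omega
        · omega
      have hi1 : i = a + 1 := by
        by_cases h2 : 2 ≤ i
        · have := h.cover _ _ (up h2) (by omega)
          omega
        · omega
      omega
    have hi1 : i = a + 1 := by
      by_cases h2 : 2 ≤ i
      · have := h.cover _ _ (up' h2) (by omega)
        omega
      · omega
    refine ⟨a + 1, b, by omega, pos, down, stair', ?_, ?_, ?_⟩
    · intro p q hs hpq
      rcases (hS p q).1 hs with h1 | h1 | h1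
      · have := h.cover p q h1 hpq
        omega
      all_goals omega
    · intro p q hp hpq hpar' hs
      rcases (hS p q).1 hs with h1 | h1 | h1
      · have := h.cover p q h1 hpq
        exact (hS _ _).2 (Or.inl (h.row p q (by omega) hpq hpar' h1))
      · rw [h1.1, h1.2]; exact hij'
      · omega
    · intro p q hq hpq hpar' hs
      rcases (hS p q).1 hs with h1 | h1 | h1
      · exact (hS _ _).2 (Or.inl (h.col p q hq hpq hpar' h1))
      all_goals omega

theorem IsPartition.le_of_le_s13 {lam : ℕ → ℕ} (h : IsPartition lam) {i i' : ℕ} (hi : 1 ≤ i)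
    (hii : i ≤ i') : lam i' ≤ lam i := by
  induction i', hii using Nat.le_induction with
  | base => exact le_rfl
  | succ n hn ih => exact (h.1 n (by omega)).trans ih

theorem IsPartition.mem_diagram_of_le {lam : ℕ → ℕ} (h : IsPartition lam) (i j i' j' : ℕ)
    (hs : (i, j) ∈ diagram lam) (hi : 1 ≤ i') (hii : i' ≤ i) (hj : 1 ≤ j') (hjj : j' ≤ j) :
    (i', j') ∈ diagram lam :=
  ⟨hi, hj, hjj.trans (hs.2.2.trans (h.le_of_le_s13 hi hii))⟩

theorem mem_diagram_staircase {l i j : ℕ} :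
    (i, j) ∈ diagram (fun i => l + 1 - i) ↔ 1 ≤ i ∧ 1 ≤ j ∧ i + j ≤ l + 1 := by
  simp only [diagram, Set.mem_ofPred_eq]
  omega

theorem isSplit_staircase (l : ℕ) :
    IsSplit l 0 0 (fun i j => (i, j) ∈ diagram (fun i => l + 1 - i)) := by
  simp only [mem_diagram_staircase]
  constructor <;> intros <;> omega

theorem IsSplit.dominoStep {l a b : ℕ} {nu mu : ℕ → ℕ}
    (h : IsSplit l a b (fun i j => (i, j) ∈ diagram nu)) (hab : a + b ≤ l)
    (hstep : DominoStep nu mu) :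
    ∃ a' b', a' + b' ≤ a + b + 1 ∧ IsSplit l a' b' (fun i j => (i, j) ∈ diagram mu) := by
  obtain ⟨-, hmu, hsub, hd⟩ := hstep
  have key : ∀ x y : ℕ × ℕ, diagram mu \ diagram nu = {x, y} →
      x ∉ diagram nu ∧ y ∉ diagram nu ∧ ∀ z, z ∈ diagram mu ↔ z ∈ diagram nu ∨ z = x ∨ z = y := by
    intro x y hxy
    have hz : ∀ z, (z ∈ diagram mu ∧ z ∉ diagram nu) ↔ z = x ∨ z = y := fun z => by
      rw [← Set.mem_sdiff, hxy]; simp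
    refine ⟨((hz x).2 (Or.inl rfl)).2, ((hz y).2 (Or.inr rfl)).2, fun z => ?_⟩
    have := @hsub z
    have := hz z
    tauto
  rcases hd with ⟨i, j, -, -, hs⟩ | ⟨i, j, -, -, hs⟩
  · obtain ⟨hx, hy, hz⟩ := key _ _ hs
    exact h.add_horizontal hab (fun i j hs => ⟨hs.1, hs.2.1⟩) hmu.mem_diagram_of_le i j hx hy
      (fun p q => by simpa using hz (p, q))
  · obtain ⟨hx, hy, hz⟩ := key _ _ hs
    obtain ⟨a', b', hab', h'⟩ := h.swap.add_horizontal (S' := fun i j => (j, i) ∈ diagram mu)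
      (by omega) (fun i j hs => ⟨hs.2.1, hs.1⟩)
      (fun i j i' j' hs h1 h2 h3 h4 => hmu.mem_diagram_of_le j i j' i' hs h3 h4 h1 h2) j i hx hy
      (fun p q => by simpa [and_comm] using hz (q, p))
    exact ⟨b', a', by omega, h'.swap⟩

theorem ObtainedBy.exists_isSplit {l w : ℕ} (hw : w ≤ l + 1) {lam : ℕ → ℕ}
    (h : ObtainedBy (fun i => l + 1 - i) w lam) :
    ∃ a b, a + b ≤ w ∧ IsSplit l a b (fun i j => (i, j) ∈ diagram lam) := by
  obtain ⟨f, h0, rfl, hf⟩ := h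
  suffices H : ∀ k ≤ w, ∃ a b, a + b ≤ k ∧ IsSplit l a b (fun i j => (i, j) ∈ diagram (f k)) from
    H w le_rfl
  intro k
  induction k with
  | zero =>
    intro _
    exact ⟨0, 0, le_rfl, h0 ▸ isSplit_staircase l⟩
  | succ k ih =>
    intro hk
    obtain ⟨a, b, hab, hs⟩ := ih (by omega)
    obtain ⟨a', b', hab', hs'⟩ := hs.dominoStep (by omega) (hf k (by omega))
    exact ⟨a', b', by omega, hs'⟩

/-- A perfect matching of the nodes satisfying `T` along edges of the square grid: `H i j` says
that `(i, j)` is matched with `(i, j + 1)`, and `V i j` that it is matched with `(i + 1, j)`. -/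
structure IsGridMatching (T H V : ℕ → ℕ → Prop) : Prop where
  cover : ∀ i j, T i j →
    H i j ∨ V i j ∨ (∃ j', j = j' + 1 ∧ H i j') ∨ (∃ i', i = i' + 1 ∧ V i' j)
  memH : ∀ i j, H i j → T i j ∧ T i (j + 1)
  memV : ∀ i j, V i j → T i j ∧ T (i + 1) j
  origin : ∀ i j, H i j → ¬ V i j
  terminus : ∀ i j, H (i + 1) j → ¬ V i (j + 1)
  HH : ∀ i j, H i j → ¬ H i (j + 1)
  VV : ∀ i j, V i j → ¬ V (i + 1) j
  HV : ∀ i j, H i j → ¬ V i (j + 1)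
  VH : ∀ i j, V i j → ¬ H (i + 1) j

theorem IsGridMatching.swap {T H V : ℕ → ℕ → Prop} (h : IsGridMatching T H V) :
    IsGridMatching (fun i j => T j i) (fun i j => V j i) (fun i j => H j i) where
  cover i j ht := by
    rcases h.cover j i ht with h | h | h | h
    · exact Or.inr (Or.inl h)
    · exact Or.inl h
    · exact Or.inr (Or.inr (Or.inr h))
    · exact Or.inr (Or.inr (Or.inl h))
  memH i j := h.memV j i
  memV i j := h.memH j i
  origin i j hv hh := h.origin j i hh hv
  terminus i j hv hh := h.terminus j i hh hv
  HH i j := h.VV j i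
  VV i j := h.HH j i
  HV i j := h.VH j i
  VH i j := h.HV j i

theorem IsSplit.horizontal {l a b : ℕ} {S H V : ℕ → ℕ → Prop} (h : IsSplit l a b S)
    (hab : a + b ≤ l + 1) (hm : IsGridMatching (fun i j => S i j ∧ l + 2 ≤ i + j) H V)
    (i j : ℕ) (hi : i ≤ a) (hl : l + 2 ≤ i + j) (hp : (i + j + l) % 2 = 0) (hs : S i j) :
    H i j := by
  induction j using Nat.strong_induction_on generalizing i with
  | _ j ih =>
    have hi1 := (h.pos i j hs).1
    rcases hm.cover i j ⟨hs, hl⟩ with h1 | h1 | ⟨j', rfl, h1⟩ | ⟨i', rfl, h1⟩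
    · exact h1
    · have ht := (hm.memV i j h1).2
      have hc := h.cover _ _ ht.1 ht.2
      obtain ⟨j', rfl⟩ : ∃ j', j = j' + 1 := ⟨j - 1, by omega⟩
      have := ih j' (by omega) (i + 1) (by omega) (by omega) (by omega)
        (h.down _ _ _ _ ht.1 (by omega) le_rfl (by omega) (by omega))
      exact absurd h1 (hm.terminus i j' this)
    · have ht := (hm.memH i j' h1).1
      obtain ⟨j'', rfl⟩ : ∃ j'', j' = j'' + 1 := ⟨j' - 1, by omega⟩
      have := ih j'' (by omega) i hi (by omega) (by omega)
        (h.down _ _ _ _ ht.1 (by omega) le_rfl (by omega) (by omega))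
      exact absurd h1 (hm.HH i j'' this)
    · have ht := (hm.memV i' j h1).1
      have := (h.pos _ _ ht.1).1
      obtain ⟨j', rfl⟩ : ∃ j', j = j' + 1 := ⟨j - 1, by omega⟩
      have := ih j' (by omega) i' (by omega) (by omega) (by omega)
        (h.down _ _ _ _ ht.1 (by omega) le_rfl (by omega) (by omega))
      exact absurd h1 (hm.HV i' j' this)

theorem isGridMatching_of_partition {X : Set (ℕ × ℕ)} {P : Set (Set (ℕ × ℕ))}
    (hd : ∀ d ∈ P, IsDomino d) (hP : P.PairwiseDisjoint id) (hU : ⋃₀ P = X) :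
    IsGridMatching (fun i j => (i, j) ∈ X) (fun i j => {(i, j), (i, j + 1)} ∈ P)
      (fun i j => {(i, j), (i + 1, j)} ∈ P) := by
  subst hU
  have eq : ∀ d ∈ P, ∀ e ∈ P, ∀ x ∈ d, x ∈ e → ∀ y ∈ d, y ∈ e := by
    intro d hd e he x hx hx' y hy
    exact hP.elim_set hd he x hx hx' ▸ hy
  refine ⟨?_, ?_, ?_, ?_, ?_, ?_, ?_, ?_, ?_⟩
  · rintro i j ⟨d, hdP, hx⟩
    rcases hd d hdP with ⟨p, q, -, -, rfl⟩ | ⟨p, q, -, -, rfl⟩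
    · rcases hx with hx | hx
      · obtain ⟨rfl, rfl⟩ := Prod.mk.inj hx
        exact Or.inl hdP
      · obtain ⟨rfl, rfl⟩ := Prod.mk.inj hx
        exact Or.inr (Or.inr (Or.inl ⟨q, rfl, hdP⟩))
    · rcases hx with hx | hx
      · obtain ⟨rfl, rfl⟩ := Prod.mk.inj hx
        exact Or.inr (Or.inl hdP)
      · obtain ⟨rfl, rfl⟩ := Prod.mk.inj hx
        exact Or.inr (Or.inr (Or.inr ⟨p, rfl, hdP⟩))
  · exact fun i j h => ⟨⟨_, h, by simp⟩, ⟨_, h, by simp⟩⟩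
  · exact fun i j h => ⟨⟨_, h, by simp⟩, ⟨_, h, by simp⟩⟩
  · intro i j h h'
    simpa using eq _ h _ h' (i, j) (by simp) (by simp) (i, j + 1) (by simp)
  · intro i j h h'
    simpa using eq _ h _ h' (i + 1, j + 1) (by simp) (by simp) (i + 1, j) (by simp)
  · intro i j h h'
    simpa [Nat.add_assoc] using eq _ h _ h' (i, j + 1) (by simp) (by simp) (i, j) (by simp)
  · intro i j h h'
    simpa [Nat.add_assoc] using eq _ h _ h' (i + 1, j) (by simp) (by simp) (i, j) (by simp)
  · intro i j h h'
    simpa using eq _ h _ h' (i, j + 1) (by simp) (by simp) (i, j) (by simp)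
  · intro i j h h'
    simpa using eq _ h _ h' (i + 1, j) (by simp) (by simp) (i, j) (by simp)

/-- The dominoes tiling a split diagram outside the staircase. -/
def splitTiling (l a b : ℕ) (S : ℕ → ℕ → Prop) : Set (Set (ℕ × ℕ)) :=
  {d | ∃ i j, S i j ∧ l + 2 ≤ i + j ∧ (i + j + l) % 2 = 0 ∧
    ((i ≤ a ∧ d = {(i, j), (i, j + 1)}) ∨ (j ≤ b ∧ d = {(i, j), (i + 1, j)}))}

theorem IsSplit.isDomino {l a b : ℕ} {S : ℕ → ℕ → Prop} (h : IsSplit l a b S) :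
    ∀ d ∈ splitTiling l a b S, IsDomino d := by
  rintro d ⟨i, j, hs, -, -, ⟨-, hd⟩ | ⟨-, hd⟩⟩
  · exact Or.inl ⟨i, j, (h.pos i j hs).1, (h.pos i j hs).2, hd⟩
  · exact Or.inr ⟨i, j, (h.pos i j hs).1, (h.pos i j hs).2, hd⟩

theorem splitTiling_pairwiseDisjoint {l a b : ℕ} (hab : a + b ≤ l + 1) (S : ℕ → ℕ → Prop) :
    (splitTiling l a b S).PairwiseDisjoint id := by
  rintro d ⟨i, j, -, hl, hp, hd⟩ e ⟨i', j', -, hl', hp', he⟩ hne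
  refine Set.disjoint_left.2 ?_
  rintro ⟨p, q⟩ hx hy
  apply hne
  rcases hd with ⟨ha, rfl⟩ | ⟨ha, rfl⟩ <;> rcases he with ⟨ha', rfl⟩ | ⟨ha', rfl⟩ <;>
    simp only [id, Set.mem_insert_iff, Set.mem_singleton_iff, Prod.mk.injEq] at hx hy
  · obtain rfl : i = i' := by omega
    obtain rfl : j = j' := by omega
    rfl
  · omega
  · omega
  · obtain rfl : i = i' := by omega
    obtain rfl : j = j' := by omega
    rfl

theorem IsSplit.sUnion_splitTiling {l a b : ℕ} {S : ℕ → ℕ → Prop} (h : IsSplit l a b S)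
    (hab : a + b ≤ l + 1) :
    ⋃₀ splitTiling l a b S = {x | S x.1 x.2 ∧ l + 2 ≤ x.1 + x.2} := by
  ext ⟨p, q⟩
  simp only [Set.mem_sUnion, Set.mem_ofPred_eq]
  constructor
  · rintro ⟨d, ⟨i, j, hs, hl, hp, ⟨ha, rfl⟩ | ⟨ha, rfl⟩⟩, hx⟩ <;>
      rcases hx with hx | hx <;> obtain ⟨rfl, rfl⟩ := Prod.mk.inj hx
    · exact ⟨hs, hl⟩
    · exact ⟨h.row _ _ ha hl hp hs, by omega⟩
    · exact ⟨hs, hl⟩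
    · exact ⟨h.col _ _ ha hl hp hs, by omega⟩
  · rintro ⟨hs, hl⟩
    obtain ⟨hp1, hq1⟩ := h.pos _ _ hs
    rcases h.cover _ _ hs hl with hc | hc <;> by_cases hp : (p + q + l) % 2 = 0
    · exact ⟨_, ⟨p, q, hs, hl, hp, Or.inl ⟨hc, rfl⟩⟩, by simp⟩
    · obtain ⟨q', rfl⟩ : ∃ q', q = q' + 1 := ⟨q - 1, by omega⟩
      exact ⟨_, ⟨p, q', h.down _ _ _ _ hs hp1 le_rfl (by omega) (by omega), by omega, by omega,
        Or.inl ⟨hc, rfl⟩⟩, by simp⟩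
    · exact ⟨_, ⟨p, q, hs, hl, hp, Or.inr ⟨hc, rfl⟩⟩, by simp⟩
    · obtain ⟨p', rfl⟩ : ∃ p', p = p' + 1 := ⟨p - 1, by omega⟩
      exact ⟨_, ⟨p', q, h.down _ _ _ _ hs (by omega) (by omega) hq1 le_rfl, by omega, by omega,
        Or.inr ⟨hc, rfl⟩⟩, by simp⟩

theorem IsSplit.eq_splitTiling {l a b : ℕ} {S : ℕ → ℕ → Prop} (h : IsSplit l a b S)
    (hab : a + b ≤ l + 1) {P : Set (Set (ℕ × ℕ))} (hd : ∀ d ∈ P, IsDomino d)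
    (hP : P.PairwiseDisjoint id) (hU : ⋃₀ P = {x | S x.1 x.2 ∧ l + 2 ≤ x.1 + x.2}) :
    P = splitTiling l a b S := by
  have hm := isGridMatching_of_partition hd hP hU
  have hm' : IsGridMatching (fun i j => S j i ∧ l + 2 ≤ i + j)
      (fun i j => {(j, i), (j + 1, i)} ∈ P) (fun i j => {(j, i), (j, i + 1)} ∈ P) := by
    simpa only [Set.mem_ofPred_eq, add_comm] using hm.swap
  have hsub : splitTiling l a b S ⊆ P := by
    rintro d ⟨i, j, hs, hl, hp, ⟨ha, rfl⟩ | ⟨ha, rfl⟩⟩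
    · exact h.horizontal hab hm i j ha hl hp hs
    · exact h.swap.horizontal (by omega) hm' j i ha (by omega) (by omega) hs
  refine Set.Subset.antisymm (fun d hdP => ?_) hsub
  obtain ⟨x, hx⟩ : d.Nonempty := by
    rcases hd d hdP with ⟨i, j, -, -, rfl⟩ | ⟨i, j, -, -, rfl⟩ <;> exact Set.insert_nonempty _ _
  have hxU : x ∈ ⋃₀ splitTiling l a b S := by
    rw [h.sUnion_splitTiling hab, ← hU]
    exact ⟨d, hdP, hx⟩
  obtain ⟨e, he, hxe⟩ := hxU
  rwa [hP.elim_set hdP (hsub he) x hx hxe]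

/-- If `lam` is obtained from the staircase `(l, l-1, …, 2, 1)` by successively
adding `w ≤ l + 1` dominoes, then the skew diagram `[lam] \ [staircase]` can be
partitioned into dominoes in exactly one way. -/
theorem stmt13 (l w : ℕ) (hw : w ≤ l + 1) (lam : ℕ → ℕ)
    (h : ObtainedBy (fun i => l + 1 - i) w lam) :
    ∃! P : Set (Set (ℕ × ℕ)),
      (∀ d ∈ P, IsDomino d) ∧ P.PairwiseDisjoint id ∧
        ⋃₀ P = diagram lam \ diagram (fun i => l + 1 - i) := by
  obtain ⟨a, b, hab, hs⟩ := h.exists_isSplit hw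
  have hX : diagram lam \ diagram (fun i => l + 1 - i) =
      {x | (x.1, x.2) ∈ diagram lam ∧ l + 2 ≤ x.1 + x.2} := by
    ext ⟨i, j⟩
    rw [Set.mem_sdiff, mem_diagram_staircase, Set.mem_ofPred_eq]
    refine and_congr_right fun hx => ?_
    have h1 : 1 ≤ i := hx.1
    have h2 : 1 ≤ j := hx.2.1
    dsimp only
    omega
  rw [hX]
  refine ⟨splitTiling l a b _, ⟨hs.isDomino, splitTiling_pairwiseDisjoint (by omega) _,
    hs.sUnion_splitTiling (by omega)⟩, ?_⟩
  rintro P ⟨hd, hP, hU⟩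
  exact hs.eq_splitTiling (by omega) hd hP hU
end

section
/- Let λ be a partition with exactly l nonzero parts, λ_1 > l, and λ_l ≥ 2. If the ladder L_{l+1}(λ) is not disconnected, then λ_i ≥ l − i + 2 for every 1 ≤ i ≤ l. -/
/-- Let `lam` be a partition with exactly `l` nonzero parts, `lam 1 > l`, and
`lam l ≥ 2`.  If the ladder `L_{l+1}(lam)` is not disconnected, then
`lam r ≥ l - r + 2` for every `1 ≤ r ≤ l`. -/
theorem stmt15 (lam : ℕ → ℕ) (hlam : IsPartition lam) (l : ℕ) (hl : 1 ≤ l)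
    (hparts : ∀ r, 1 ≤ r → (0 < lam r ↔ r ≤ l))
    (h1 : l < lam 1) (hll : 2 ≤ lam l)
    (hconn : ¬LadderDisconnected lam (l + 1)) :
    ∀ r, 1 ≤ r → r ≤ l → l - r + 2 ≤ lam r := by
  intro r hr1 hrl
  by_contra hlt
  have hne1 : r ≠ 1 := by rintro rfl; omega
  have hnel : r ≠ l := by rintro rfl; omega
  refine hconn ⟨1, r, l, le_rfl, by omega, by omega, by omega, ?_, ?_, ?_⟩ <;>
    simp only [diagram, Set.mem_ofPred_eq] <;> omega
end
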